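/- Let H ≤ F be a subgroup. If the action of H on (∂F, μ) is dissipative, i.e. there exists a measurable set W ⊆ ∂F with μ(W) > 0 and μ(hW ∩ h′W) = 0 for all h ≠ h′ in H, then the Poincaré series Σ_{h∈H} (2m−1)^{−|h|} converges. -/

import Mathlib

open MeasureTheory Filter Topology
open scoped ENNReal symmDiff

noncomputable section

/-- A letter of the alphabet `A ∪ A⁻¹` for the free group on `Fin m`. -/
abbrev Letter (m : ℕ) := Fin m × Bool

/-- The inverse letter. -/
def linv {m : ℕ} (x : Letter m) : Letter m := (x.1, !x.2)

/-- A sequence of letters is reduced if no letter is followed by its inverse. -/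
def IsRedSeq {m : ℕ} (ω : ℕ → Letter m) : Prop := ∀ n, ω (n + 1) ≠ linv (ω n)

/-- The boundary `∂F`: infinite reduced words. -/
abbrev Boundary (m : ℕ) := {ω : ℕ → Letter m // IsRedSeq ω}

/-- Word length of an element of the free group. -/
def wlen {m : ℕ} (g : FreeGroup (Fin m)) : ℕ := g.toWord.length

/-- The truncation `[ω]ₙ`: the group element given by the first `n` letters of `ω`. -/
def trunc {m : ℕ} (ω : Boundary m) (n : ℕ) : FreeGroup (Fin m) :=
  FreeGroup.mk (List.ofFn fun i : Fin n => ω.1 i)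

/-- Cylinder set `C_g`. -/
def cylinder {m : ℕ} (g : FreeGroup (Fin m)) : Set (Boundary m) :=
  {ω | trunc ω (wlen g) = g}

/-- The Gromov product `(g|ω)`: length of the longest common initial segment of the
reduced word of `g` and `ω`. -/
def gromov {m : ℕ} (g : FreeGroup (Fin m)) (ω : Boundary m) : ℕ :=
  sSup {k | ∀ i < k, g.toWord[i]? = some (ω.1 i)}

/-- The Busemann function `b_ω(g) = |g| - 2 (g|ω)`. -/
def busemann {m : ℕ} (g : FreeGroup (Fin m)) (ω : Boundary m) : ℤ :=
  (wlen g : ℤ) - 2 * (gromov g ω : ℤ)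

/-- The number of letters cancelled in the free reduction of the concatenation
of a finite word `w` with an infinite reduced word `ω`. -/
def cancelLen {m : ℕ} (w : List (Letter m)) (ω : ℕ → Letter m) : ℕ :=
  sSup {k | k ≤ w.length ∧ ∀ i < k, w[w.length - 1 - i]? = some (linv (ω i))}

/-- The sequence of letters of the free reduction of (reduced word of `g`) ++ `ω`. -/
def actSeq {m : ℕ} (g : FreeGroup (Fin m)) (ω : Boundary m) (n : ℕ) : Letter m :=
  if h : n < g.toWord.length - cancelLen g.toWord ω.1
  then g.toWord[n]'(by omega)
  else ω.1 (n - (g.toWord.length - cancelLen g.toWord ω.1) + cancelLen g.toWord ω.1)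

theorem linv_linv {m : ℕ} (x : Letter m) : linv (linv x) = x := by
  simp [linv]

theorem toWord_chain {m : ℕ} (g : FreeGroup (Fin m)) {j : ℕ} (hj : j + 1 < g.toWord.length) :
    g.toWord[j + 1]'hj ≠ linv (g.toWord[j]'(by omega)) := by
  intro h
  have hsplit : g.toWord = g.toWord.take j ++
      (g.toWord[j]'(by omega)) :: (g.toWord[j+1]'hj) :: g.toWord.drop (j + 2) := by
    conv_lhs => rw [← List.take_append_drop j g.toWord]
    congr 1
    rw [List.drop_eq_getElem_cons (by omega)]
    congr 1
    rw [List.drop_eq_getElem_cons (by omega)]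
  rw [h] at hsplit
  have hred : FreeGroup.reduce g.toWord = g.toWord := FreeGroup.reduce_toWord g
  exact FreeGroup.reduce.not (by rw [hred, hsplit]; rfl)

theorem cancelLen_spec {m : ℕ} (w : List (Letter m)) (ω : ℕ → Letter m) :
    cancelLen w ω ≤ w.length ∧
      ∀ i < cancelLen w ω, w[w.length - 1 - i]? = some (linv (ω i)) := by
  have : cancelLen w ω ∈
      {k | k ≤ w.length ∧ ∀ i < k, w[w.length - 1 - i]? = some (linv (ω i))} := by
    apply Nat.sSup_mem ⟨0, by simp⟩ ⟨w.length, fun x hx => hx.1⟩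
  exact this

theorem cancelLen_max {m : ℕ} (w : List (Letter m)) (ω : ℕ → Letter m)
    (hlt : cancelLen w ω < w.length) :
    w[w.length - 1 - cancelLen w ω]? ≠ some (linv (ω (cancelLen w ω))) := by
  intro hcon
  have hmem : cancelLen w ω + 1 ∈
      {k | k ≤ w.length ∧ ∀ i < k, w[w.length - 1 - i]? = some (linv (ω i))} := by
    refine ⟨hlt, fun i hi => ?_⟩
    rcases Nat.lt_succ_iff_lt_or_eq.mp hi with h | h
    · exact (cancelLen_spec w ω).2 i h
    · subst h; exact hcon
  have := le_csSup ⟨w.length, fun x hx => hx.1⟩ hmem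
  simp only [cancelLen] at this ⊢
  omega

theorem isRedSeq_actSeq {m : ℕ} (g : FreeGroup (Fin m)) (ω : Boundary m) :
    IsRedSeq (actSeq g ω) := by
  intro n
  obtain ⟨hkle, hcan⟩ := cancelLen_spec g.toWord ω.1
  by_cases h1 : n + 1 < g.toWord.length - cancelLen g.toWord ω.1
  · have h0 : n < g.toWord.length - cancelLen g.toWord ω.1 := by omega
    rw [show actSeq g ω (n + 1) = g.toWord[n + 1]'(by omega) from dif_pos h1,
        show actSeq g ω n = g.toWord[n]'(by omega) from dif_pos h0]
    exact toWord_chain g (by omega)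
  · by_cases h0 : n < g.toWord.length - cancelLen g.toWord ω.1
    · have hklt : cancelLen g.toWord ω.1 < g.toWord.length := by omega
      have hidx : n = g.toWord.length - 1 - cancelLen g.toWord ω.1 := by omega
      have e0 : actSeq g ω n = g.toWord[n]'(by omega) := dif_pos h0
      have e1 : actSeq g ω (n + 1) =
          ω.1 (n + 1 - (g.toWord.length - cancelLen g.toWord ω.1) +
            cancelLen g.toWord ω.1) := dif_neg h1
      have harg : n + 1 - (g.toWord.length - cancelLen g.toWord ω.1) +
          cancelLen g.toWord ω.1 = cancelLen g.toWord ω.1 := by omega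
      rw [harg] at e1
      rw [e0, e1]
      intro hcon
      apply cancelLen_max g.toWord ω.1 hklt
      subst hidx
      rw [List.getElem?_eq_getElem (by omega), hcon, linv_linv]
    · have e0 : actSeq g ω n =
          ω.1 (n - (g.toWord.length - cancelLen g.toWord ω.1) +
            cancelLen g.toWord ω.1) := dif_neg h0
      have e1 : actSeq g ω (n + 1) =
          ω.1 (n + 1 - (g.toWord.length - cancelLen g.toWord ω.1) +
            cancelLen g.toWord ω.1) := dif_neg (by omega)
      have harg : n + 1 - (g.toWord.length - cancelLen g.toWord ω.1) +
          cancelLen g.toWord ω.1 =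
          (n - (g.toWord.length - cancelLen g.toWord ω.1) + cancelLen g.toWord ω.1) + 1 := by
        omega
      rw [e0, e1, harg]
      exact ω.2 _

/-- The boundary action of `F` on `∂F`: `g · ω` is the free reduction of the
concatenation of the reduced word of `g` with `ω`. -/
def bact {m : ℕ} (g : FreeGroup (Fin m)) (ω : Boundary m) : Boundary m :=
  ⟨actSeq g ω, isRedSeq_actSeq g ω⟩


theorem cancelLen_eq_of_spec {m : ℕ} {w : List (Letter m)} {ω : ℕ → Letter m} {k : ℕ}
    (hk : k ≤ w.length) (hcan : ∀ i < k, w[w.length - 1 - i]? = some (linv (ω i)))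
    (hmax : k < w.length → w[w.length - 1 - k]? ≠ some (linv (ω k))) :
    cancelLen w ω = k := by
  obtain ⟨h1, h2⟩ := cancelLen_spec w ω
  have hle : k ≤ cancelLen w ω := le_csSup ⟨w.length, fun x hx => hx.1⟩ ⟨hk, hcan⟩
  by_contra hne
  have hlt : k < cancelLen w ω := by omega
  exact hmax (by omega) (h2 k hlt)

theorem cancelLen_congr {m : ℕ} {w : List (Letter m)} {ω ω' : ℕ → Letter m}
    (h : ∀ i < w.length, ω i = ω' i) : cancelLen w ω = cancelLen w ω' := by
  obtain ⟨h1, h2⟩ := cancelLen_spec w ω'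
  refine cancelLen_eq_of_spec h1 (fun i hi => ?_) (fun hlt => ?_)
  · rw [h i (by omega)]
    exact h2 i hi
  · rw [h _ hlt]
    exact cancelLen_max w ω' hlt

theorem actSeq_of_lt {m : ℕ} {g : FreeGroup (Fin m)} {ω : Boundary m} {n : ℕ}
    (h : n < g.toWord.length - cancelLen g.toWord ω.1) :
    actSeq g ω n = g.toWord[n]'(by omega) := dif_pos h

theorem actSeq_of_le {m : ℕ} {g : FreeGroup (Fin m)} {ω : Boundary m} {n : ℕ}
    (h : g.toWord.length - cancelLen g.toWord ω.1 ≤ n) :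
    actSeq g ω n = ω.1 (n - (g.toWord.length - cancelLen g.toWord ω.1) +
      cancelLen g.toWord ω.1) := dif_neg (by omega)

/-- The boundary action of `g` maps sequences with a long common prefix to sequences with a
long common prefix. -/
theorem actSeq_congr {m : ℕ} {g : FreeGroup (Fin m)} {ω ω' : Boundary m} {N j : ℕ}
    (hN : wlen g ≤ N) (h : ∀ i < N, ω.1 i = ω'.1 i)
    (hj : j + 2 * cancelLen g.toWord ω.1 < N + wlen g) :
    actSeq g ω j = actSeq g ω' j := by
  unfold wlen at hN hj
  have hc : cancelLen g.toWord ω.1 = cancelLen g.toWord ω'.1 :=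
    cancelLen_congr fun i hi => h i (by omega)
  have hle := (cancelLen_spec g.toWord ω.1).1
  by_cases hlt : j < g.toWord.length - cancelLen g.toWord ω.1
  · rw [actSeq_of_lt hlt, actSeq_of_lt (hc ▸ hlt)]
  · rw [actSeq_of_le (by omega), actSeq_of_le (by omega), ← hc]
    exact h _ (by omega)

theorem wlen_inv {m : ℕ} (g : FreeGroup (Fin m)) : wlen g⁻¹ = wlen g := by
  simp [wlen, FreeGroup.toWord_inv, FreeGroup.invRev]

theorem getElem?_toWord_inv {m : ℕ} (g : FreeGroup (Fin m)) {i : ℕ}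
    (hi : i < g.toWord.length) :
    g⁻¹.toWord[i]? = some (linv (g.toWord[g.toWord.length - 1 - i]'(by omega))) := by
  rw [FreeGroup.toWord_inv, FreeGroup.invRev, List.getElem?_reverse (by simpa using hi)]
  rw [List.length_map, List.getElem?_map, List.getElem?_eq_getElem (by omega)]
  rfl

theorem getElem_of_lt_cancelLen {m : ℕ} {w : List (Letter m)} {ω : ℕ → Letter m} {i : ℕ}
    (hi : i < cancelLen w ω) :
    w[w.length - 1 - i]'(by have := (cancelLen_spec w ω).1; omega) = linv (ω i) := by
  obtain ⟨h1, h2⟩ := cancelLen_spec w ω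
  have := h2 i hi
  rwa [List.getElem?_eq_getElem (by omega), Option.some.injEq] at this

theorem cancelLen_inv_bact {m : ℕ} (g : FreeGroup (Fin m)) (ω : Boundary m) :
    cancelLen g⁻¹.toWord (bact g ω).1 = wlen g - cancelLen g.toWord ω.1 := by
  have hlen : g⁻¹.toWord.length = g.toWord.length := wlen_inv g
  have h1 := (cancelLen_spec g.toWord ω.1).1
  unfold wlen
  refine cancelLen_eq_of_spec (by omega) (fun i hi => ?_) (fun hlt => ?_)
  · rw [hlen, getElem?_toWord_inv g (by omega)]
    change _ = some (linv (actSeq g ω i))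
    rw [actSeq_of_lt hi]
    congr 3
    omega
  · rw [hlen, getElem?_toWord_inv g (by omega)]
    change _ ≠ some (linv (actSeq g ω _))
    rw [actSeq_of_le le_rfl]
    obtain ⟨k, hk⟩ : ∃ k, cancelLen g.toWord ω.1 = k + 1 :=
      Nat.exists_eq_succ_of_ne_zero (by omega)
    intro hcon
    rw [Option.some.injEq] at hcon
    have hcon' := congrArg linv hcon
    rw [linv_linv, linv_linv] at hcon'
    have hlast := getElem_of_lt_cancelLen (w := g.toWord) (ω := ω.1) (i := k) (by omega)
    apply ω.2 k
    rw [← hlast, show k + 1 = g.toWord.length - cancelLen g.toWord ω.1 -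
      (g.toWord.length - cancelLen g.toWord ω.1) + cancelLen g.toWord ω.1 by omega, ← hcon']
    congr 1
    omega

theorem bact_inv_bact {m : ℕ} (g : FreeGroup (Fin m)) (ω : Boundary m) :
    bact g⁻¹ (bact g ω) = ω := by
  have hlen : g⁻¹.toWord.length = g.toWord.length := wlen_inv g
  have hc := cancelLen_inv_bact g ω
  unfold wlen at hc
  have h1 := (cancelLen_spec g.toWord ω.1).1
  apply Subtype.ext
  funext n
  change actSeq g⁻¹ (bact g ω) n = ω.1 n
  by_cases hn : n < cancelLen g.toWord ω.1
  · rw [actSeq_of_lt (by omega)]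
    have := getElem?_toWord_inv g (i := n) (by omega)
    rw [List.getElem?_eq_getElem (by omega), Option.some.injEq] at this
    rw [this, getElem_of_lt_cancelLen hn, linv_linv]
  · rw [actSeq_of_le (by omega)]
    change actSeq g ω _ = _
    rw [hc, hlen, actSeq_of_le (by omega)]
    exact congrArg ω.1 (by omega)

theorem image_bact {m : ℕ} (g : FreeGroup (Fin m)) (W : Set (Boundary m)) :
    bact g '' W = bact g⁻¹ ⁻¹' W := by
  refine congrFun (Set.image_eq_preimage_of_inverse (bact_inv_bact g) fun ω => ?_) W
  simpa using bact_inv_bact g⁻¹ ω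

/-- The first `n` letters of a boundary point. -/
def initial {m : ℕ} (n : ℕ) (ω : Boundary m) : Fin n → Letter m := fun i => ω.1 i

theorem initial_eq_iff {m n : ℕ} {ω ω' : Boundary m} :
    initial n ω = initial n ω' ↔ ∀ i < n, ω.1 i = ω'.1 i := by
  simp [initial, funext_iff, Fin.forall_iff]

theorem measurable_initial {m : ℕ} (n : ℕ) : Measurable (initial n : Boundary m → _) :=
  measurable_pi_lambda _ fun _ => (measurable_pi_apply _).comp measurable_subtype_coe

theorem measurableSet_of_initial {m n : ℕ} {s : Set (Boundary m)}
    (h : ∀ ω ω', initial n ω = initial n ω' → ω ∈ s → ω' ∈ s) : MeasurableSet s := by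
  have : s = initial n ⁻¹' (initial n '' s) := by
    refine subset_antisymm (Set.subset_preimage_image _ _) ?_
    rintro ω ⟨ω', hω', he⟩
    exact h _ _ he hω'
  rw [this]
  exact measurable_initial n (Set.toFinite _).measurableSet

theorem measurable_bact {m : ℕ} (g : FreeGroup (Fin m)) : Measurable (bact g) := by
  refine Measurable.subtype_mk (measurable_pi_lambda _ fun j => ?_)
  intro s _
  refine measurableSet_of_initial (n := j + wlen g + 1) fun ω ω' he hω => ?_
  have hle : cancelLen g.toWord ω.1 ≤ wlen g := (cancelLen_spec g.toWord ω.1).1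
  have := actSeq_congr (g := g) (j := j) (by omega) (initial_eq_iff.1 he) (by omega)
  rw [Set.mem_preimage] at hω ⊢
  rwa [← this]

theorem toWord_trunc {m : ℕ} (ω : Boundary m) (n : ℕ) :
    (trunc ω n).toWord = List.ofFn fun i : Fin n => ω.1 i := by
  rw [trunc, FreeGroup.toWord_mk]
  apply FreeGroup.IsReduced.reduce_eq
  rw [FreeGroup.IsReduced, List.isChain_iff_getElem]
  intro i hi
  simp only [List.getElem_ofFn]
  intro h1
  by_contra h2
  refine ω.2 i (Prod.ext h1.symm ?_)
  simp only [linv]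
  cases h : (ω.1 i).2 <;> cases h' : (ω.1 (i + 1)).2 <;> simp_all

theorem wlen_trunc {m : ℕ} (ω : Boundary m) (n : ℕ) : wlen (trunc ω n) = n := by
  simp [wlen, toWord_trunc]

theorem cylinder_trunc {m : ℕ} (ω : Boundary m) (n : ℕ) :
    cylinder (trunc ω n) = initial n ⁻¹' {initial n ω} := by
  ext ω'
  change trunc ω' (wlen (trunc ω n)) = _ ↔ _
  rw [wlen_trunc, ← FreeGroup.toWord_inj, toWord_trunc, toWord_trunc,
    List.ofFn_inj]
  rfl

/-- An inequality between finite measures on the boundary may be checked on small cylinders. -/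
theorem measure_le_mul_of_cylinder {m : ℕ} (μ ν : Measure (Boundary m)) [IsFiniteMeasure ν]
    {c : ℝ≥0∞} (hc₀ : c ≠ 0) (hc : c ≠ ∞) (N : ℕ)
    (h : ∀ ω, ∀ n ≥ N, μ (initial n ⁻¹' {initial n ω}) ≤ c * ν (initial n ⁻¹' {initial n ω}))
    (W : Set (Boundary m)) : μ W ≤ c * ν W := by
  have hopen : ∀ U : Set (Boundary m), IsOpen U → μ U ≤ c * ν U := by
    intro U hU
    let V : ℕ → Set (Boundary m) := fun n => {ω | initial n ⁻¹' {initial n ω} ⊆ U}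
    have hVU : ∀ n, V n ⊆ U := fun n ω hω => hω rfl
    have hVmono : Monotone V := by
      intro a b hab ω hω ω' hω'
      refine hω (initial_eq_iff.2 fun i hi => ?_)
      exact initial_eq_iff.1 hω' i (by omega)
    have hUV : U = ⋃ n, V n := by
      refine subset_antisymm (fun ω hω => ?_) (Set.iUnion_subset hVU)
      obtain ⟨O, hO, rfl⟩ := isOpen_induced_iff.1 hU
      obtain ⟨I, u, hu, hsub⟩ := isOpen_pi_iff.1 hO ω.1 hω
      refine Set.mem_iUnion.2 ⟨I.sup id + 1, fun ω' hω' => hsub fun i hi => ?_⟩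
      rw [initial_eq_iff.1 hω' i (Nat.lt_succ_of_le (Finset.le_sup (f := id) hi))]
      exact (hu i hi).2
    have hV : ∀ n ≥ N, μ (V n) ≤ c * ν (V n) := by
      intro n hn
      classical
      let S : Finset (Fin n → Letter m) := (Set.toFinite (initial n '' V n)).toFinset
      have hS : V n = initial n ⁻¹' S := by
        ext ω
        simp only [S, Set.Finite.coe_toFinset, Set.mem_preimage, Set.mem_image]
        refine ⟨fun hω => ⟨ω, hω, rfl⟩, ?_⟩
        rintro ⟨ω', hω', he⟩
        change _ ⊆ U
        rw [← he]
        exact hω'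
      have hmeas : ∀ y ∈ S, MeasurableSet (initial n ⁻¹' {y} : Set (Boundary m)) :=
        fun y _ => measurable_initial n (measurableSet_singleton y)
      rw [hS, ← sum_measure_preimage_singleton S hmeas, ← sum_measure_preimage_singleton S hmeas,
        Finset.mul_sum]
      refine Finset.sum_le_sum fun y hy => ?_
      obtain ⟨ω, -, rfl⟩ := (Set.Finite.mem_toFinset _).1 hy
      exact h ω n hn
    have hlim := tendsto_measure_iUnion_atTop (μ := μ) hVmono
    rw [← hUV] at hlim
    refine le_of_tendsto hlim ((eventually_ge_atTop N).mono fun n hn => (hV n hn).trans ?_)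
    gcongr
    exact hVU n
  have : TopologicalSpace.PseudoMetrizableSpace (Boundary m) :=
    Topology.IsInducing.subtypeVal.pseudoMetrizableSpace
  rw [W.measure_eq_iInf_isOpen ν]
  simp only [ENNReal.mul_iInf_of_ne hc₀ hc]
  exact le_iInf fun U => le_iInf fun hWU => le_iInf fun hU => (measure_mono hWU).trans (hopen U hU)

theorem measure_le_mul_measure_image_bact {m : ℕ} (hm : 2 ≤ m) (μ : Measure (Boundary m))
    [IsProbabilityMeasure μ]
    (hμ : ∀ g : FreeGroup (Fin m), g ≠ 1 →
      μ (cylinder g) = ((2 * m * (2 * m - 1) ^ (wlen g - 1) : ℕ) : ℝ≥0∞)⁻¹)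
    (g : FreeGroup (Fin m)) {W : Set (Boundary m)} (hW : MeasurableSet W) :
    μ W ≤ (((2 * m - 1) ^ wlen g : ℕ) : ℝ≥0∞) * μ (bact g '' W) := by
  have hcyl : ∀ (ω : Boundary m) (n : ℕ), 0 < n → μ (initial n ⁻¹' {initial n ω}) =
      ((2 * m * (2 * m - 1) ^ (n - 1) : ℕ) : ℝ≥0∞)⁻¹ := by
    intro ω n hn
    rw [← cylinder_trunc, hμ, wlen_trunc]
    intro h1
    have := wlen_trunc ω n
    rw [h1] at this
    simp [wlen] at this
    omega
  rw [image_bact, ← Measure.map_apply (measurable_bact _) hW]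
  have hpos : 0 < 2 * m - 1 := by omega
  refine measure_le_mul_of_cylinder μ _ (by exact_mod_cast (pow_pos hpos _).ne')
    (ENNReal.natCast_ne_top _) (2 * wlen g + 1) ?_ W
  intro ω n hn
  have hk : cancelLen g.toWord ω.1 ≤ wlen g := (cancelLen_spec g.toWord ω.1).1
  have hck := cancelLen_inv_bact g ω
  have hinv := wlen_inv g
  set k := cancelLen g.toWord ω.1
  have hsub : initial (n + wlen g - 2 * k) ⁻¹' {initial (n + wlen g - 2 * k) (bact g ω)} ⊆
      bact g⁻¹ ⁻¹' (initial n ⁻¹' {initial n ω}) := by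
    intro ω' hω'
    refine initial_eq_iff.2 fun i hi => ?_
    conv_rhs => rw [← bact_inv_bact g ω]
    exact (actSeq_congr (by omega) (initial_eq_iff.1 hω'.symm) (by omega)).symm
  rw [Measure.map_apply (measurable_bact _)
    (measurable_initial n (measurableSet_singleton _)), hcyl ω n (by omega)]
  calc ((2 * m * (2 * m - 1) ^ (n - 1) : ℕ) : ℝ≥0∞)⁻¹
      = (((2 * m - 1) ^ wlen g : ℕ) : ℝ≥0∞) *
          ((2 * m * (2 * m - 1) ^ (n - 1) * (2 * m - 1) ^ wlen g : ℕ) : ℝ≥0∞)⁻¹ := by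
        rw [Nat.cast_mul _ ((2 * m - 1) ^ wlen g),
          ENNReal.mul_inv (Or.inr (ENNReal.natCast_ne_top _)) (Or.inl (ENNReal.natCast_ne_top _)),
          mul_left_comm, ENNReal.mul_inv_cancel (by exact_mod_cast (pow_pos hpos _).ne')
            (ENNReal.natCast_ne_top _), mul_one]
    _ ≤ (((2 * m - 1) ^ wlen g : ℕ) : ℝ≥0∞) *
          ((2 * m * (2 * m - 1) ^ (n + wlen g - 2 * k - 1) : ℕ) : ℝ≥0∞)⁻¹ := by
        refine mul_le_mul_right (ENNReal.inv_le_inv.2 (Nat.cast_le.2 ?_)) _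
        rw [mul_assoc (2 * m), ← pow_add]
        exact Nat.mul_le_mul_left _ (Nat.pow_le_pow_right hpos (by omega))
    _ ≤ _ := by
        rw [← hcyl (bact g ω) _ (by omega)]
        exact mul_le_mul_right (measure_mono hsub) _

/-- **Dissipativity implies convergence of the Poincaré series.** If the boundary action
of `H` on `(∂F, μ)` has a nontrivial wandering set, then `Σ_{h∈H} (2m-1)^{-|h|} < ∞`. -/
theorem poincare_series_converges_of_dissipative (m : ℕ) (hm : 2 ≤ m)
    (μ : Measure (Boundary m)) [IsProbabilityMeasure μ]
    (hμ : ∀ g : FreeGroup (Fin m), g ≠ 1 →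
      μ (cylinder g) = ((2 * m * (2 * m - 1) ^ (wlen g - 1) : ℕ) : ℝ≥0∞)⁻¹)
    (H : Subgroup (FreeGroup (Fin m)))
    (hdiss : ∃ W : Set (Boundary m), MeasurableSet W ∧ 0 < μ W ∧
      (∀ h h' : H, h ≠ h' →
        μ (bact (h : FreeGroup (Fin m)) '' W ∩ bact (h' : FreeGroup (Fin m)) '' W) = 0)) :
    Summable (fun h : H => (((2 * m - 1 : ℕ) : ℝ) ^ wlen (h : FreeGroup (Fin m)))⁻¹) := by
  obtain ⟨W, hW, hWpos, hdisj⟩ := hdiss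
  have : Countable (FreeGroup (Fin m)) := FreeGroup.toWord_injective.countable
  have hsum : ∑' h : H, μ (bact (h : FreeGroup (Fin m)) '' W) ≤ 1 := by
    rw [← measure_iUnion₀ (fun h h' hne => hdisj h h' hne) fun h => ?_]
    · exact prob_le_one
    · rw [image_bact]
      exact (measurable_bact _ hW).nullMeasurableSet
  have hpos : 0 < 2 * m - 1 := by omega
  have hterm : ∀ h : H, (((2 * m - 1) ^ wlen (h : FreeGroup (Fin m)) : ℕ) : ℝ≥0∞)⁻¹ * μ W ≤
      μ (bact (h : FreeGroup (Fin m)) '' W) := fun h =>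
    (ENNReal.inv_mul_le_iff (by exact_mod_cast (pow_pos hpos _).ne')
      (ENNReal.natCast_ne_top _)).2 (measure_le_mul_measure_image_bact hm μ hμ h hW)
  have hfin : ∑' h : H, (((2 * m - 1) ^ wlen (h : FreeGroup (Fin m)) : ℕ) : ℝ≥0∞)⁻¹ ≠ ∞ := by
    intro htop
    have hle := (ENNReal.tsum_le_tsum hterm).trans hsum
    rw [ENNReal.tsum_mul_right, htop, ENNReal.top_mul hWpos.ne'] at hle
    exact absurd hle (by simp)
  refine (ENNReal.summable_toReal hfin).congr fun h => ?_
  rw [ENNReal.toReal_inv, ENNReal.toReal_natCast, Nat.cast_pow]
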